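/- The group LocAut(π₂) of all local automorphisms of π₂ satisfies LocAut(π₂) = { exp(∇) : ∇ is a local derivation of π₂ }, where exp(∇) = I + Σ_{n=1}^∞ ∇ⁿ/n! and I is the identity map of π₂. -/

import Mathlib

noncomputable section

/-- The multiplication of the 5-dimensional naturally graded nilpotent associative
algebra `π₂`, given on the basis `e₁, …, e₅` (indices `0, …, 4`) by
`e₁e₁ = e₂`, `e₁e₂ = e₂e₁ = e₃`, `e₁e₄ = e₄e₁ = e₅`, `e₄e₄ = e₅`. -/
def pi2Mul (x y : Fin 5 → ℂ) : Fin 5 → ℂ :=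
  ![0, x 0 * y 0, x 0 * y 1 + x 1 * y 0, 0, x 0 * y 3 + x 3 * y 0 + x 3 * y 3]

/-- An automorphism of `π₂`: a bijective linear operator respecting the multiplication. -/
def IsPi2Aut (Φ : (Fin 5 → ℂ) →ₗ[ℂ] (Fin 5 → ℂ)) : Prop :=
  Function.Bijective Φ ∧ ∀ x y, Φ (pi2Mul x y) = pi2Mul (Φ x) (Φ y)

/-- A local automorphism of `π₂`. -/
def IsPi2LocAut (Φ : (Fin 5 → ℂ) →ₗ[ℂ] (Fin 5 → ℂ)) : Prop :=
  ∀ x : Fin 5 → ℂ, ∃ ψ : (Fin 5 → ℂ) →ₗ[ℂ] (Fin 5 → ℂ), IsPi2Aut ψ ∧ Φ x = ψ x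

/-- A derivation of `π₂`. -/
def IsPi2Der (D : (Fin 5 → ℂ) →ₗ[ℂ] (Fin 5 → ℂ)) : Prop :=
  ∀ x y, D (pi2Mul x y) = pi2Mul (D x) y + pi2Mul x (D y)

/-- A local derivation of `π₂`. -/
def IsPi2LocDer (f : (Fin 5 → ℂ) →ₗ[ℂ] (Fin 5 → ℂ)) : Prop :=
  ∀ x : Fin 5 → ℂ, ∃ D : (Fin 5 → ℂ) →ₗ[ℂ] (Fin 5 → ℂ), IsPi2Der D ∧ f x = D x

/-- `Φ` is the exponential `exp(T) = I + ∑_{n≥1} Tⁿ/n!` of the endomorphism `T`. -/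
def IsExpOf (Φ T : (Fin 5 → ℂ) →ₗ[ℂ] (Fin 5 → ℂ)) : Prop :=
  ∀ x : Fin 5 → ℂ, Φ x = ∑' n : ℕ, ((n.factorial : ℂ)⁻¹) • (T ^ n) x

open Polynomial

section LogarithmInBanachAlgebra

variable {A : Type*} [NormedRing A] [NormedAlgebra ℂ A]

/-- If `n ^ 3 = 0`, the truncated logarithm `n - n ^ 2 / 2` is a logarithm of `1 + n`. -/
theorem exp_truncated_log {n : A} (hn : n ^ 3 = 0) :
    NormedSpace.exp (n - (2⁻¹ : ℂ) • n ^ 2) = 1 + n := by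
  have h4 : n ^ 4 = 0 := by rw [pow_succ, hn, zero_mul]
  have hsq : (n - (2⁻¹ : ℂ) • n ^ 2) ^ 2 = n ^ 2 := by
    have : (n - (2⁻¹ : ℂ) • n ^ 2) ^ 2 = n ^ 2 - n ^ 3 + (4⁻¹ : ℂ) • n ^ 4 := by
      simp only [pow_succ, pow_zero, one_mul, sub_mul, mul_sub, smul_mul_assoc, mul_smul_comm,
        mul_assoc, smul_sub, smul_smul]
      module
    rw [this, hn, h4, smul_zero, sub_zero, add_zero]
  have hcube : (n - (2⁻¹ : ℂ) • n ^ 2) ^ 3 = 0 := by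
    rw [pow_succ, hsq, mul_sub, mul_smul_comm, ← pow_succ, ← pow_add, hn, h4, smul_zero, sub_zero]
  rw [NormedSpace.exp_eq_tsum ℂ]
  dsimp only
  rw [tsum_eq_sum (s := Finset.range 3) fun k hk => ?_]
  · simp [Finset.sum_range_succ, hsq, Nat.factorial]
    abel
  · obtain ⟨m, rfl⟩ := Nat.exists_eq_add_of_le (not_lt.mp (by simpa using hk : ¬ k < 3))
    rw [pow_add, hcube, zero_mul, smul_zero]

/-- Let `χ` be a finite family of continuous characters of a complex Banach algebra whose common
kernel consists of elements with vanishing cube. Then every element on which no `χ i` vanishes has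
a logarithm. -/
theorem exists_exp_eq_of_characters [CompleteSpace A] {ι : Type*} [Fintype ι] (χ : ι → A →ₐ[ℂ] ℂ)
    (hχ : ∀ i, Continuous (χ i)) (hnil : ∀ n, (∀ i, χ i n = 0) → n ^ 3 = 0)
    (g : A) (hg : ∀ i, χ i g ≠ 0) : ∃ t, NormedSpace.exp t = g := by
  classical
  let : NormedAlgebra ℚ A := NormedAlgebra.restrictScalars ℚ ℂ A
  let P : ℂ[X] := Lagrange.interpolate (Finset.univ.image fun i => χ i g) id Complex.log
  have hP (i) : P.eval (χ i g) = Complex.log (χ i g) :=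
    Lagrange.eval_interpolate_at_node (v := id) Complex.log (Function.injective_id.injOn)
      (Finset.mem_image_of_mem _ (Finset.mem_univ i))
  let l := aeval g P
  have hl (i) : χ i l = Complex.log (χ i g) := by
    rw [← hP, ← aeval_algHom_apply, coe_aeval_eq_eval]
  have hlg : Commute l g := by
    simpa [l] using ((Commute.all P X).map (aeval g))
  let n := NormedSpace.exp (-l) * g - 1
  have hn : n ^ 3 = 0 := hnil n fun i => by
    rw [map_sub, map_mul, map_one, NormedSpace.map_exp (χ i) (hχ i), map_neg, hl,
      ← Complex.exp_eq_exp_ℂ, Complex.exp_neg, Complex.exp_log (hg i), inv_mul_cancel₀ (hg i),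
      sub_self]
  have hln : Commute l n :=
    ((((Commute.refl l).neg_right).exp_right).mul_right hlg).sub_right (Commute.one_right l)
  refine ⟨l + (n - (2⁻¹ : ℂ) • n ^ 2), ?_⟩
  rw [NormedSpace.exp_add_of_commute (hln.sub_right ((hln.pow_right 2).smul_right _)),
    exp_truncated_log hn, add_sub_cancel, ← mul_assoc,
    ← NormedSpace.exp_add_of_commute ((Commute.refl l).neg_right), add_neg_cancel,
    NormedSpace.exp_zero, one_mul]

/-- A version of `exists_exp_eq_of_characters` for a subalgebra. -/
theorem Subalgebra.exists_mem_exp_eq_of_characters [FiniteDimensional ℂ A] (S : Subalgebra ℂ A)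
    {ι : Type*} [Fintype ι] (χ : ι → S →ₐ[ℂ] ℂ) (hnil : ∀ n, (∀ i, χ i n = 0) → n ^ 3 = 0)
    (g : S) (hg : ∀ i, χ i g ≠ 0) : ∃ t ∈ S, NormedSpace.exp t = (g : A) := by
  let : NormedAlgebra ℚ S := NormedAlgebra.restrictScalars ℚ ℂ _
  let : NormedAlgebra ℚ A := NormedAlgebra.restrictScalars ℚ ℂ _
  have : FiniteDimensional ℂ S := FiniteDimensional.finiteDimensional_submodule S.toSubmodule
  have : CompleteSpace S := FiniteDimensional.complete ℂ _
  obtain ⟨t, ht⟩ := exists_exp_eq_of_characters χ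
    (fun i => (χ i).toLinearMap.continuous_of_finiteDimensional) hnil g hg
  refine ⟨t, t.2, ?_⟩
  rw [← ht]
  exact (NormedSpace.map_exp S.val continuous_subtype_val t).symm

/-- A finite-dimensional subalgebra is stable under the exponential, on whose values characters do
not vanish. -/
theorem Subalgebra.exp_mem_and_character_ne_zero [FiniteDimensional ℂ A] (S : Subalgebra ℂ A)
    (t : S) : ∃ h : NormedSpace.exp (t : A) ∈ S, ∀ χ : S →ₐ[ℂ] ℂ, χ ⟨_, h⟩ ≠ 0 := by
  let : NormedAlgebra ℚ S := NormedAlgebra.restrictScalars ℚ ℂ _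
  let : NormedAlgebra ℚ A := NormedAlgebra.restrictScalars ℚ ℂ _
  have : FiniteDimensional ℂ S := FiniteDimensional.finiteDimensional_submodule S.toSubmodule
  have : CompleteSpace S := FiniteDimensional.complete ℂ _
  have h : (NormedSpace.exp t : S) = NormedSpace.exp (t : A) :=
    NormedSpace.map_exp S.val continuous_subtype_val t
  refine ⟨h ▸ Subtype.prop _, fun χ => ?_⟩
  have h' : (⟨NormedSpace.exp (t : A), h ▸ Subtype.prop _⟩ : S) = NormedSpace.exp t :=
    Subtype.ext h.symm
  rw [h', NormedSpace.map_exp χ χ.toLinearMap.continuous_of_finiteDimensional,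
    ← Complex.exp_eq_exp_ℂ]
  exact Complex.exp_ne_zero _

end LogarithmInBanachAlgebra

/-- The indices `j ≤ i` for the partial order governing the matrices of local derivations of `π₂`
in the basis `pi2Basis`. -/
def pi2Below : Fin 5 → Finset (Fin 5) := ![{0}, {1}, {0, 2}, {0, 1, 3}, {0, 1, 2, 4}]

theorem pi2Below_self (i : Fin 5) : i ∈ pi2Below i := by decide +revert

theorem pi2Below_trans {i j k : Fin 5} : j ∈ pi2Below i → k ∈ pi2Below j → k ∈ pi2Below i := by
  decide +revert

theorem pi2Below_antisymm {i j : Fin 5} : j ∈ pi2Below i → i ∈ pi2Below j → i = j := by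
  decide +revert

/-- The incidence algebra of the partial order `pi2Below`. -/
def pi2Incidence : Subalgebra ℂ (Matrix (Fin 5) (Fin 5) ℂ) where
  carrier := {M | ∀ i j, j ∉ pi2Below i → M i j = 0}
  mul_mem' {M N} hM hN i j hij := by
    rw [Matrix.mul_apply]
    refine Finset.sum_eq_zero fun k _ => ?_
    by_cases hk : k ∈ pi2Below i
    · rw [hN k j fun h => hij (pi2Below_trans hk h), mul_zero]
    · rw [hM i k hk, zero_mul]
  add_mem' {M N} hM hN i j hij := by
    rw [Matrix.add_apply, hM i j hij, hN i j hij, add_zero]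
  algebraMap_mem' c i j hij := by
    rw [Matrix.algebraMap_matrix_apply, if_neg]
    rintro rfl
    exact hij (pi2Below_self i)

/-- The diagonal entries are characters of the incidence algebra. -/
def pi2Char (i : Fin 5) : pi2Incidence →ₐ[ℂ] ℂ :=
  AlgHom.ofLinearMap ((Matrix.entryLinearMap ℂ ℂ i i).comp pi2Incidence.val.toLinearMap)
    (by simp) fun M N => by
      change (M.1 * N.1) i i = M.1 i i * N.1 i i
      rw [Matrix.mul_apply]
      refine Finset.sum_eq_single i (fun k _ hk => ?_) (by simp)
      by_cases h : k ∈ pi2Below i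
      · rw [N.2 k i fun h' => hk (pi2Below_antisymm h h').symm, mul_zero]
      · rw [M.2 i k h, zero_mul]

theorem pi2Incidence_pow_three_eq_zero (N : pi2Incidence) (hN : ∀ i, pi2Char i N = 0) :
    N ^ 3 = 0 := by
  obtain ⟨N, hmem⟩ := N
  have hdiag (i) : N i i = 0 := hN i
  have hzero (i j) (h : j ∉ (pi2Below i).erase i) : N i j = 0 := by
    by_cases hij : j = i
    · rw [hij, hdiag]
    · exact hmem i j fun h' => h (Finset.mem_erase.mpr ⟨hij, h'⟩)
  have hno : ∀ i k l j : Fin 5, k ∉ (pi2Below i).erase i ∨ l ∉ (pi2Below k).erase k ∨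
      j ∉ (pi2Below l).erase l := by
    decide
  ext i j
  change (N ^ 3) i j = 0
  simp only [pow_succ, pow_zero, one_mul, Matrix.mul_apply, Finset.sum_mul]
  refine Finset.sum_eq_zero fun l _ => Finset.sum_eq_zero fun k _ => ?_
  rcases hno i k l j with h | h | h <;> simp [hzero _ _ h]

section

attribute [local instance] Matrix.linftyOpNormedRing Matrix.linftyOpNormedAlgebra

theorem exists_exp_eq_of_mem_pi2Incidence {M : Matrix (Fin 5) (Fin 5) ℂ} (hM : M ∈ pi2Incidence)
    (hdiag : ∀ i, M i i ≠ 0) : ∃ T ∈ pi2Incidence, NormedSpace.exp T = M :=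
  pi2Incidence.exists_mem_exp_eq_of_characters pi2Char pi2Incidence_pow_three_eq_zero ⟨M, hM⟩ hdiag

theorem exp_mem_pi2Incidence {T : Matrix (Fin 5) (Fin 5) ℂ} (hT : T ∈ pi2Incidence) :
    NormedSpace.exp T ∈ pi2Incidence ∧ ∀ i, NormedSpace.exp T i i ≠ 0 :=
  have ⟨h, hχ⟩ := pi2Incidence.exp_mem_and_character_ne_zero ⟨T, hT⟩
  ⟨h, fun i => hχ (pi2Char i)⟩

end

/-- Coordinates of `π₂` in which local automorphisms have matrices in `pi2Incidence`. -/
def pi2Coord : (Fin 5 → ℂ) ≃ₗ[ℂ] (Fin 5 → ℂ) where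
  toFun x := ![x 0, x 0 + x 3, x 1, x 1 + x 4, x 2]
  invFun y := ![y 0, y 2, y 4, y 1 - y 0, y 3 - y 2]
  map_add' x y := by
    ext i; fin_cases i <;> simp <;> ring
  map_smul' c x := by
    ext i; fin_cases i <;> simp <;> ring
  left_inv x := by
    ext i; fin_cases i <;> simp
  right_inv y := by
    ext i; fin_cases i <;> simp

/-- The basis dual to `pi2Coord`. -/
def pi2Basis : Module.Basis (Fin 5) ℂ (Fin 5 → ℂ) := Module.Basis.ofEquivFun pi2Coord

/-- The matrix of an operator in the basis `pi2Basis`. -/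
def pi2Matrix : ((Fin 5 → ℂ) →ₗ[ℂ] (Fin 5 → ℂ)) ≃ₐ[ℂ] Matrix (Fin 5) (Fin 5) ℂ :=
  LinearMap.toMatrixAlgEquiv pi2Basis

theorem pi2Matrix_apply (f : (Fin 5 → ℂ) →ₗ[ℂ] (Fin 5 → ℂ)) (i j : Fin 5) :
    pi2Matrix f i j = pi2Coord (f (pi2Coord.symm (Pi.single j 1))) i := by
  simp [pi2Matrix, LinearMap.toMatrixAlgEquiv_apply, pi2Basis]

theorem pi2Coord_apply_eq_sum (f : (Fin 5 → ℂ) →ₗ[ℂ] (Fin 5 → ℂ)) (x : Fin 5 → ℂ) (i : Fin 5) :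
    pi2Coord (f x) i = ∑ j, pi2Matrix f i j * pi2Coord x j := by
  have h : (pi2Matrix f).mulVec (pi2Basis.repr x) i = pi2Basis.repr (f x) i :=
    congrFun (LinearMap.toMatrix_mulVec_repr pi2Basis pi2Basis f x) i
  simpa [pi2Basis, Matrix.mulVec, dotProduct] using h.symm

attribute [local instance] Matrix.linftyOpNormedRing Matrix.linftyOpNormedAlgebra in
theorem isExpOf_iff (Φ T : (Fin 5 → ℂ) →ₗ[ℂ] (Fin 5 → ℂ)) :
    IsExpOf Φ T ↔ pi2Matrix Φ = NormedSpace.exp (pi2Matrix T) := by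
  have h (x) : HasSum (fun n : ℕ => ((n.factorial : ℂ)⁻¹) • (T ^ n) x)
      (pi2Matrix.symm (NormedSpace.exp (pi2Matrix T)) x) := by
    let L : Matrix (Fin 5) (Fin 5) ℂ →ₗ[ℂ] (Fin 5 → ℂ) :=
      (LinearMap.applyₗ x).comp pi2Matrix.symm.toLinearMap
    have := (NormedSpace.exp_series_hasSum_exp' (𝕂 := ℂ) (pi2Matrix T)).map L
      L.continuous_of_finiteDimensional
    convert this using 1
    · ext1 n
      simp [L]
    · rfl
  rw [← AlgEquiv.eq_symm_apply]
  refine ⟨fun H => LinearMap.ext fun x => (H x).trans (h x).tsum_eq, fun H x => ?_⟩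
  rw [H, (h x).tsum_eq]

theorem apply_of_pi2Matrix_mem {f : (Fin 5 → ℂ) →ₗ[ℂ] (Fin 5 → ℂ)}
    (hf : pi2Matrix f ∈ pi2Incidence) (x : Fin 5 → ℂ) :
    f x 0 = pi2Matrix f 0 0 * x 0 ∧
    f x 3 = pi2Matrix f 1 1 * (x 0 + x 3) - f x 0 ∧
    f x 1 = pi2Matrix f 2 0 * x 0 + pi2Matrix f 2 2 * x 1 ∧
    f x 4 = pi2Matrix f 3 0 * x 0 + pi2Matrix f 3 1 * (x 0 + x 3) +
      pi2Matrix f 3 3 * (x 1 + x 4) - f x 1 ∧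
    f x 2 = pi2Matrix f 4 0 * x 0 + pi2Matrix f 4 1 * (x 0 + x 3) + pi2Matrix f 4 2 * x 1 +
      pi2Matrix f 4 4 * x 2 := by
  have h (i) : pi2Coord (f x) i = ∑ j ∈ pi2Below i, pi2Matrix f i j * pi2Coord x j := by
    rw [pi2Coord_apply_eq_sum]
    refine (Finset.sum_subset (Finset.subset_univ _) fun j _ hj => ?_).symm
    rw [hf i j hj, zero_mul]
  have h0 := h 0
  have h1 := h 1
  have h2 := h 2
  have h3 := h 3
  have h4 := h 4
  simp [pi2Below, pi2Coord] at h0 h1 h2 h3 h4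
  refine ⟨h0, ?_, h2, ?_, ?_⟩
  · linear_combination h1
  · linear_combination h3
  · linear_combination h4

theorem pi2Mul_e1_e1 : pi2Mul (Pi.single 0 1) (Pi.single 0 1) = Pi.single 1 1 := by
  ext i; fin_cases i <;> simp [pi2Mul]

theorem pi2Mul_e1_e2 : pi2Mul (Pi.single 0 1) (Pi.single 1 1) = Pi.single 2 1 := by
  ext i; fin_cases i <;> simp [pi2Mul]

theorem pi2Mul_e1_e4 : pi2Mul (Pi.single 0 1) (Pi.single 3 1) = Pi.single 4 1 := by
  ext i; fin_cases i <;> simp [pi2Mul]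

theorem pi2Mul_e4_e4 : pi2Mul (Pi.single 3 1) (Pi.single 3 1) = Pi.single 4 1 := by
  ext i; fin_cases i <;> simp [pi2Mul]

theorem pi2Mul_e2_e4 : pi2Mul (Pi.single 1 1) (Pi.single 3 1) = 0 := by
  ext i; fin_cases i <;> simp [pi2Mul]

/-- The general form of an automorphism of `π₂` (for `a, s ≠ 0`). -/
def pi2AutMap (a s b c d c' d' : ℂ) : (Fin 5 → ℂ) →ₗ[ℂ] (Fin 5 → ℂ) where
  toFun x := ![a * x 0, b * x 0 + a ^ 2 * x 1,
    c * x 0 + 2 * a * b * x 1 + a ^ 3 * x 2 + c' * x 3, (s - a) * x 0 + s * x 3,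
    d * x 0 + (s ^ 2 - a ^ 2) * x 1 + d' * x 3 + s ^ 2 * x 4]
  map_add' x y := by
    ext i; fin_cases i <;> simp <;> ring
  map_smul' k x := by
    ext i; fin_cases i <;> simp <;> ring

/-- The general form of a derivation of `π₂`. -/
def pi2DerMap (a s b c d c' d' : ℂ) : (Fin 5 → ℂ) →ₗ[ℂ] (Fin 5 → ℂ) where
  toFun x := ![a * x 0, b * x 0 + 2 * a * x 1,
    c * x 0 + 2 * b * x 1 + 3 * a * x 2 + c' * x 3, (s - a) * x 0 + s * x 3,
    d * x 0 + 2 * (s - a) * x 1 + d' * x 3 + 2 * s * x 4]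
  map_add' x y := by
    ext i; fin_cases i <;> simp <;> ring
  map_smul' k x := by
    ext i; fin_cases i <;> simp <;> ring

theorem pi2AutMap_apply (a s b c d c' d' : ℂ) (x : Fin 5 → ℂ) :
    pi2AutMap a s b c d c' d' x = ![a * x 0, b * x 0 + a ^ 2 * x 1,
      c * x 0 + 2 * a * b * x 1 + a ^ 3 * x 2 + c' * x 3, (s - a) * x 0 + s * x 3,
      d * x 0 + (s ^ 2 - a ^ 2) * x 1 + d' * x 3 + s ^ 2 * x 4] := rfl

theorem pi2DerMap_apply (a s b c d c' d' : ℂ) (x : Fin 5 → ℂ) :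
    pi2DerMap a s b c d c' d' x = ![a * x 0, b * x 0 + 2 * a * x 1,
      c * x 0 + 2 * b * x 1 + 3 * a * x 2 + c' * x 3, (s - a) * x 0 + s * x 3,
      d * x 0 + 2 * (s - a) * x 1 + d' * x 3 + 2 * s * x 4] := rfl

theorem isPi2Aut_pi2AutMap {a s : ℂ} (ha : a ≠ 0) (hs : s ≠ 0) (b c d c' d' : ℂ) :
    IsPi2Aut (pi2AutMap a s b c d c' d') := by
  refine ⟨?_, fun x y => ?_⟩
  · have hinj : Function.Injective (pi2AutMap a s b c d c' d') := by
      rw [injective_iff_map_eq_zero]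
      intro x hx
      have h (i) := congrFun hx i
      have h0 := h 0
      have h1 := h 1
      have h2 := h 2
      have h3 := h 3
      have h4 := h 4
      simp [pi2AutMap_apply, ha] at h0
      simp [pi2AutMap_apply, h0, ha] at h1
      simp [pi2AutMap_apply, h0, hs] at h3
      simp [pi2AutMap_apply, h0, h1, h3, ha] at h2
      simp [pi2AutMap_apply, h0, h1, h3, hs] at h4
      ext i; fin_cases i <;> assumption
    exact ⟨hinj, LinearMap.injective_iff_surjective.mp hinj⟩
  · ext i; fin_cases i <;> simp [pi2AutMap_apply, pi2Mul] <;> ring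

theorem isPi2Der_pi2DerMap (a s b c d c' d' : ℂ) : IsPi2Der (pi2DerMap a s b c d c' d') := by
  intro x y
  ext i; fin_cases i <;> simp [pi2DerMap_apply, pi2Mul] <;> ring

theorem IsPi2Aut.exists_eq_pi2AutMap {ψ : (Fin 5 → ℂ) →ₗ[ℂ] (Fin 5 → ℂ)} (hψ : IsPi2Aut ψ) :
    ∃ a s b c d c' d', a ≠ 0 ∧ s ≠ 0 ∧ ψ = pi2AutMap a s b c d c' d' := by
  obtain ⟨⟨hinj, -⟩, hmul⟩ := hψ
  set y := ψ (Pi.single 0 1) with hy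
  set z := ψ (Pi.single 3 1) with hz
  have he2 : ψ (Pi.single 1 1) = pi2Mul y y := by rw [← pi2Mul_e1_e1, hmul]
  have he3 : ψ (Pi.single 2 1) = pi2Mul y (pi2Mul y y) := by rw [← pi2Mul_e1_e2, hmul, he2]
  have he5 : ψ (Pi.single 4 1) = pi2Mul z z := by rw [← pi2Mul_e4_e4, hmul]
  have he14 : pi2Mul z z = pi2Mul y z := by rw [← he5, ← pi2Mul_e1_e4, hmul]
  have he24 : pi2Mul (pi2Mul y y) z = 0 := by rw [← he2, ← hmul, pi2Mul_e2_e4, map_zero]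
  have hne (i : Fin 5) : ψ (Pi.single i 1) ≠ 0 := by
    rw [Ne, map_eq_zero_iff ψ hinj, Pi.single_eq_zero_iff]
    exact one_ne_zero
  have hy0 : y 0 ≠ 0 := fun h => hne 2 <| by
    rw [he3]; ext i; fin_cases i <;> simp [pi2Mul, h]
  have hz0 : z 0 = 0 := by simpa [pi2Mul, hy0] using congrFun he24 2
  have hz1 : z 1 = 0 := by simpa [pi2Mul, hz0, hy0] using congrFun he14 2
  have hz3 : z 3 ≠ 0 := fun h => hne 4 <| by
    rw [he5]; ext i; fin_cases i <;> simp [pi2Mul, h, hz0]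
  have hyz : z 3 = y 0 + y 3 := by
    have h := congrFun he14 4
    simp [pi2Mul, hz0] at h
    exact mul_right_cancel₀ hz3 (h.trans (add_mul _ _ _).symm)
  refine ⟨y 0, z 3, y 1, y 2, y 4, z 2, z 4, hy0, hz3, ?_⟩
  refine (Pi.basisFun ℂ (Fin 5)).ext fun j => ?_
  rw [Pi.basisFun_apply]
  fin_cases j
  · simp only [Fin.zero_eta, ← hy]
    ext i; fin_cases i <;> simp [pi2AutMap_apply, hyz]
  · simp only [Fin.mk_one, he2]
    ext i; fin_cases i <;> simp [pi2AutMap_apply, pi2Mul, hyz] <;> ring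
  · simp only [Fin.reduceFinMk, he3]
    ext i; fin_cases i <;> simp [pi2AutMap_apply, pi2Mul]; ring
  · simp only [Fin.reduceFinMk, ← hz]
    ext i; fin_cases i <;> simp [pi2AutMap_apply, hz0, hz1]
  · simp only [Fin.reduceFinMk, he5]
    ext i; fin_cases i <;> simp [pi2AutMap_apply, pi2Mul, hz0, hz1]; ring

theorem IsPi2Der.exists_eq_pi2DerMap {D : (Fin 5 → ℂ) →ₗ[ℂ] (Fin 5 → ℂ)} (hD : IsPi2Der D) :
    ∃ a s b c d c' d', D = pi2DerMap a s b c d c' d' := by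
  have he2 := hD (Pi.single 0 1) (Pi.single 0 1)
  have he3 := hD (Pi.single 0 1) (Pi.single 1 1)
  have he5 := hD (Pi.single 3 1) (Pi.single 3 1)
  have he14 := hD (Pi.single 0 1) (Pi.single 3 1)
  have he24 := hD (Pi.single 1 1) (Pi.single 3 1)
  rw [pi2Mul_e1_e1] at he2
  rw [pi2Mul_e1_e2, he2] at he3
  rw [pi2Mul_e4_e4] at he5
  rw [pi2Mul_e1_e4, he5] at he14
  rw [pi2Mul_e2_e4, map_zero, he2] at he24
  set y := D (Pi.single 0 1) with hy
  set z := D (Pi.single 3 1) with hz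
  have hz0 : z 0 = 0 := by simpa [pi2Mul] using (congrFun he24 2).symm
  have hz1 : z 1 = 0 := by simpa [pi2Mul] using (congrFun he14 2).symm
  have hyz : z 3 = y 0 + y 3 := by
    have h := congrFun he14 4
    simp [pi2Mul, hz0] at h
    linear_combination h
  refine ⟨y 0, z 3, y 1, y 2, y 4, z 2, z 4, ?_⟩
  refine (Pi.basisFun ℂ (Fin 5)).ext fun j => ?_
  rw [Pi.basisFun_apply]
  fin_cases j
  · simp only [Fin.zero_eta, ← hy]
    ext i; fin_cases i <;> simp [pi2DerMap_apply, hyz]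
  · simp only [Fin.mk_one, he2]
    ext i; fin_cases i <;> simp [pi2DerMap_apply, pi2Mul, hyz] <;> ring
  · simp only [Fin.reduceFinMk, he3]
    ext i; fin_cases i <;> simp [pi2DerMap_apply, pi2Mul]; ring
  · simp only [Fin.reduceFinMk, ← hz]
    ext i; fin_cases i <;> simp [pi2DerMap_apply, hz0, hz1]
  · simp only [Fin.reduceFinMk, he5]
    ext i; fin_cases i <;> simp [pi2DerMap_apply, pi2Mul, hz0, hz1]; ring

theorem pi2Matrix_pi2AutMap_mem (a s b c d c' d' : ℂ) :
    pi2Matrix (pi2AutMap a s b c d c' d') ∈ pi2Incidence := by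
  intro i j hij
  rw [pi2Matrix_apply]
  fin_cases i <;> fin_cases j <;> simp [pi2Below] at hij <;>
    simp [pi2Coord, pi2AutMap_apply] <;> ring

theorem pi2Matrix_pi2AutMap_diag_ne_zero {a s : ℂ} (ha : a ≠ 0) (hs : s ≠ 0) (b c d c' d' : ℂ)
    (i : Fin 5) : pi2Matrix (pi2AutMap a s b c d c' d') i i ≠ 0 := by
  rw [pi2Matrix_apply]
  fin_cases i <;> simp [pi2Coord, pi2AutMap_apply, ha, hs]

theorem pi2Matrix_pi2DerMap_mem (a s b c d c' d' : ℂ) :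
    pi2Matrix (pi2DerMap a s b c d c' d') ∈ pi2Incidence := by
  intro i j hij
  rw [pi2Matrix_apply]
  fin_cases i <;> fin_cases j <;> simp [pi2Below] at hij <;>
    simp [pi2Coord, pi2DerMap_apply] <;> ring

theorem isPi2LocAut_iff (Φ : (Fin 5 → ℂ) →ₗ[ℂ] (Fin 5 → ℂ)) :
    IsPi2LocAut Φ ↔ pi2Matrix Φ ∈ pi2Incidence ∧ ∀ i, pi2Matrix Φ i i ≠ 0 := by
  refine ⟨fun h => ?_, fun ⟨hΦ, hdiag⟩ x => ?_⟩
  · have key (j) : ∃ a s b c d c' d', a ≠ 0 ∧ s ≠ 0 ∧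
        ∀ i, pi2Matrix Φ i j = pi2Matrix (pi2AutMap a s b c d c' d') i j := by
      obtain ⟨ψ, hψ, hx⟩ := h (pi2Coord.symm (Pi.single j 1))
      obtain ⟨a, s, b, c, d, c', d', ha, hs, rfl⟩ := hψ.exists_eq_pi2AutMap
      exact ⟨a, s, b, c, d, c', d', ha, hs, fun i => by rw [pi2Matrix_apply, hx, pi2Matrix_apply]⟩
    refine ⟨fun i j hij => ?_, fun i => ?_⟩
    · obtain ⟨a, s, b, c, d, c', d', -, -, hj⟩ := key j
      rw [hj, pi2Matrix_pi2AutMap_mem _ _ _ _ _ _ _ i j hij]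
    · obtain ⟨a, s, b, c, d, c', d', ha, hs, hi⟩ := key i
      rw [hi]
      exact pi2Matrix_pi2AutMap_diag_ne_zero ha hs _ _ _ _ _ _
  · obtain ⟨h0, h3, h1, h4, h2⟩ := apply_of_pi2Matrix_mem hΦ x
    suffices ∃ a s b c d c' d', a ≠ 0 ∧ s ≠ 0 ∧ Φ x = pi2AutMap a s b c d c' d' x by
      obtain ⟨a, s, b, c, d, c', d', ha, hs, hx⟩ := this
      exact ⟨_, isPi2Aut_pi2AutMap ha hs _ _ _ _ _, hx⟩
    have root (n : ℕ) (hn : 0 < n) (i) : ∃ a, a ≠ 0 ∧ a ^ n = pi2Matrix Φ i i := by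
      obtain ⟨a, ha⟩ := IsAlgClosed.exists_pow_nat_eq (pi2Matrix Φ i i) hn
      refine ⟨a, ?_, ha⟩
      rintro rfl
      exact hdiag i (by rw [← ha, zero_pow hn.ne'])
    by_cases hx0 : x 0 = 0
    · by_cases hx3 : x 3 = 0
      · obtain ⟨s, hs, hs2⟩ := root 2 two_pos 3
        by_cases hx1 : x 1 = 0
        · obtain ⟨a, ha, ha3⟩ := root 3 three_pos 4
          refine ⟨a, s, 0, 0, 0, 0, 0, ha, hs, ?_⟩
          ext i; fin_cases i <;> simp [pi2AutMap_apply, h0, h1, h2, h3, h4, hx0, hx1, hx3, hs2, ha3]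
        · obtain ⟨a, ha, ha2⟩ := root 2 two_pos 2
          refine ⟨a, s, (Φ x 2 - a ^ 3 * x 2) / (2 * a * x 1), 0, 0, 0, 0, ha, hs, ?_⟩
          ext i; fin_cases i <;> simp [pi2AutMap_apply, h0, h1, h3, h4, hx0, hx3, hs2, ha2]
          · field_simp
            ring
          · ring
      · obtain ⟨a, ha, ha2⟩ := root 2 two_pos 2
        refine ⟨a, pi2Matrix Φ 1 1, 0, 0, 0, (Φ x 2 - a ^ 3 * x 2) / x 3,
          (Φ x 4 - (pi2Matrix Φ 1 1 ^ 2 - a ^ 2) * x 1 - pi2Matrix Φ 1 1 ^ 2 * x 4) / x 3,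
          ha, hdiag 1, ?_⟩
        ext i; fin_cases i <;> simp [pi2AutMap_apply, h0, h1, h3, hx0, hx3, ha2]
        ring
    · set a := pi2Matrix Φ 0 0 with ha
      set s := pi2Matrix Φ 1 1 with hs
      set b := (Φ x 1 - a ^ 2 * x 1) / x 0 with hb
      refine ⟨a, s, b, (Φ x 2 - 2 * a * b * x 1 - a ^ 3 * x 2) / x 0,
        (Φ x 4 - (s ^ 2 - a ^ 2) * x 1 - s ^ 2 * x 4) / x 0, 0, 0, hdiag 0, hdiag 1, ?_⟩
      ext i; fin_cases i <;> simp [pi2AutMap_apply, h0, h3, hx0, hb] <;> ring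

theorem isPi2LocDer_iff (T : (Fin 5 → ℂ) →ₗ[ℂ] (Fin 5 → ℂ)) :
    IsPi2LocDer T ↔ pi2Matrix T ∈ pi2Incidence := by
  refine ⟨fun h i j hij => ?_, fun hT x => ?_⟩
  · obtain ⟨D, hD, hx⟩ := h (pi2Coord.symm (Pi.single j 1))
    obtain ⟨a, s, b, c, d, c', d', rfl⟩ := hD.exists_eq_pi2DerMap
    rw [pi2Matrix_apply, hx, ← pi2Matrix_apply, pi2Matrix_pi2DerMap_mem _ _ _ _ _ _ _ i j hij]
  · obtain ⟨h0, h3, h1, h4, h2⟩ := apply_of_pi2Matrix_mem hT x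
    suffices ∃ a s b c d c' d', T x = pi2DerMap a s b c d c' d' x by
      obtain ⟨a, s, b, c, d, c', d', hx⟩ := this
      exact ⟨_, isPi2Der_pi2DerMap _ _ _ _ _ _ _, hx⟩
    have two (w : ℂ) : 2 * (w / 2) = w := by ring
    have three (w : ℂ) : 3 * (w / 3) = w := by ring
    by_cases hx0 : x 0 = 0
    · by_cases hx3 : x 3 = 0
      · by_cases hx1 : x 1 = 0
        · refine ⟨pi2Matrix T 4 4 / 3, pi2Matrix T 3 3 / 2, 0, 0, 0, 0, 0, ?_⟩
          ext i; fin_cases i <;> simp [pi2DerMap_apply, h0, h1, h2, h3, h4, hx0, hx1, hx3, two, three]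
        · refine ⟨pi2Matrix T 2 2 / 2, pi2Matrix T 3 3 / 2,
            (T x 2 - 3 * (pi2Matrix T 2 2 / 2) * x 2) / (2 * x 1), 0, 0, 0, 0, ?_⟩
          ext i; fin_cases i <;> simp [pi2DerMap_apply, h0, h1, h3, h4, hx0, hx3, two]
          · field_simp
            ring
          · ring
      · set a := pi2Matrix T 2 2 / 2 with ha
        set s := pi2Matrix T 1 1
        refine ⟨a, s, 0, 0, 0, (T x 2 - 3 * a * x 2) / x 3,
          (T x 4 - 2 * (s - a) * x 1 - 2 * s * x 4) / x 3, ?_⟩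
        ext i; fin_cases i <;> simp [pi2DerMap_apply, h0, h1, h3, hx0, hx3, ha, two]; ring
    · set a := pi2Matrix T 0 0 with ha
      set s := pi2Matrix T 1 1 with hs
      set b := (T x 1 - 2 * a * x 1) / x 0 with hb
      refine ⟨a, s, b, (T x 2 - 2 * b * x 1 - 3 * a * x 2) / x 0,
        (T x 4 - 2 * (s - a) * x 1 - 2 * s * x 4) / x 0, 0, 0, ?_⟩
      ext i; fin_cases i <;> simp [pi2DerMap_apply, h0, h3, hx0, hb] <;> ring

/-- `LocAut(π₂) = { exp(T) : T ∈ LocDer(π₂) }`. -/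
theorem pi2_locAut_eq_exp_locDer :
    {Φ : (Fin 5 → ℂ) →ₗ[ℂ] (Fin 5 → ℂ) | IsPi2LocAut Φ} =
      {Φ : (Fin 5 → ℂ) →ₗ[ℂ] (Fin 5 → ℂ) |
        ∃ T : (Fin 5 → ℂ) →ₗ[ℂ] (Fin 5 → ℂ), IsPi2LocDer T ∧ IsExpOf Φ T} := by
  ext Φ
  simp only [Set.mem_ofPred_eq, isPi2LocAut_iff, isPi2LocDer_iff, isExpOf_iff]
  constructor
  · rintro ⟨hΦ, hdiag⟩
    obtain ⟨T, hT, hexp⟩ := exists_exp_eq_of_mem_pi2Incidence hΦ hdiag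
    exact ⟨pi2Matrix.symm T, by simpa using hT, by simpa using hexp.symm⟩
  · rintro ⟨T, hT, hexp⟩
    rw [hexp]
    exact exp_mem_pi2Incidence hT
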